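/- Let K be a division ring and let A, B, C, D ∈ K be pairwise distinct points. Then c_r(A,C;D,B) = (1 - c_r(A,B;C,D))⁻¹. -/

import Mathlib

/-- Cross ratio of four collinear points in the skew field of a line
of a Desargues affine plane: c_r(A,B;C,D) = ((A-D)⁻¹(B-D))((B-C)⁻¹(A-C)). -/
def crossRatio {K : Type*} [DivisionRing K] (A B C D : K) : K :=
  ((A - D)⁻¹ * (B - D)) * ((B - C)⁻¹ * (A - C))

/-- The complement to one of a cross ratio is the inverse of a permuted cross ratio. -/
theorem one_sub_crossRatio {K : Type*} [DivisionRing K] {A B C D : K}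
    (hAD : A ≠ D) (hBC : B ≠ C) :
    1 - crossRatio A B C D = (crossRatio A C D B)⁻¹ := by
  have hp : A - D ≠ 0 := sub_ne_zero.mpr hAD
  have hu : B - C ≠ 0 := sub_ne_zero.mpr hBC
  have key : (A - D) - (B - D) * ((B - C)⁻¹ * (A - C)) =
      (C - D) * ((C - B)⁻¹ * (A - B)) := by
    have hBD : B - D = (B - C) + (C - D) := by abel
    have hCB : (C - B)⁻¹ = -(B - C)⁻¹ := by rw [← neg_sub B C, inv_neg]
    have hAB : A - B = (A - C) - (B - C) := by abel
    rw [hBD, hCB, hAB, add_mul, mul_inv_cancel_left₀ hu, neg_mul, mul_sub (B - C)⁻¹ (A - C),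
      inv_mul_cancel₀ hu, neg_sub, mul_sub (C - D), mul_one]
    abel
  simp only [crossRatio, mul_inv_rev, inv_inv, mul_assoc]
  rw [← key, mul_sub _ (A - D), inv_mul_cancel₀ hp]

theorem crossRatio_ACDB {K : Type*} [DivisionRing K] (A B C D : K)
    (hAB : A ≠ B) (hAC : A ≠ C) (hAD : A ≠ D)
    (hBC : B ≠ C) (hBD : B ≠ D) (hCD : C ≠ D) :
    crossRatio A C D B = (1 - crossRatio A B C D)⁻¹ := by
  rw [one_sub_crossRatio hAD hBC, inv_inv]
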